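/- arXiv:2212.06945 — 2 statements merged into one kernel-verified Lean document; each statement's English description precedes it below -/
import Mathlib

section
/- Let X be a Banach space, φ: X → (−∞,∞] lower semicontinuous with x̄ ∈ dom φ, and x̄* ∈ X*. The following are equivalent: (i) φ is prox-bounded and x̄* is a proximal subgradient of φ at x̄; (ii) P_λ^{x̄*}φ(x̄) = {x̄} for some λ > 0; (iii) P_λ^{x̄*}φ(x̄) = {x̄} for all sufficiently small λ > 0. -/
open Filter Topology

variable {X : Type*} [NormedAddCommGroup X] [NormedSpace ℝ X]

/-- `φ` is prox-bounded: it majorizes a quadratic. -/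
def ProxBounded (φ : X → EReal) : Prop :=
  ∃ (α β : ℝ) (x₀ : X), ∀ x : X, ((α * ‖x - x₀‖ ^ 2 + β : ℝ) : EReal) ≤ φ x

/-- `xs` is a proximal subgradient of `φ` at `xbar`. -/
def ProximalSubgradient (φ : X → EReal) (xbar : X) (xs : X →L[ℝ] ℝ) : Prop :=
  ∃ (r ε : ℝ), 0 < r ∧ 0 < ε ∧ ∀ x : X, ‖x - xbar‖ < ε →
    φ xbar + ((xs (x - xbar) - r / 2 * ‖x - xbar‖ ^ 2 : ℝ) : EReal) ≤ φ x

/-- The tilted proximal mapping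
`P_λ^{x̄*} φ (x) = argmin_w { φ(w) − ⟨x̄*, w⟩ + ‖w − x‖²/(2λ) }`. -/
noncomputable def TiltedProx (φ : X → EReal) (xs : X →L[ℝ] ℝ) (lam : ℝ)
    (x : X) : Set X :=
  {w : X | ∀ v : X,
    φ w + ((-(xs w) + ‖w - x‖ ^ 2 / (2 * lam) : ℝ) : EReal) ≤
    φ v + ((-(xs v) + ‖v - x‖ ^ 2 / (2 * lam) : ℝ) : EReal)}

/-- A prox-bounded function with a proximal subgradient at `xbar` has a global quadratic minorant
that is exact at `xbar`. -/
theorem ProximalSubgradient.exists_global_minorant {φ : X → EReal} {xbar : X} {xs : X →L[ℝ] ℝ}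
    {c : ℝ} (hc : φ xbar = c) (hb : ProxBounded φ) (hs : ProximalSubgradient φ xbar xs) :
    ∃ M : ℝ, 0 < M ∧ ∀ v : X,
      ((c + (xs (v - xbar) - M * ‖v - xbar‖ ^ 2) : ℝ) : EReal) ≤ φ v := by
  obtain ⟨α, β, x₀, hb⟩ := hb
  obtain ⟨r, ε, hr, hε, hs⟩ := hs
  set d := ‖xbar - x₀‖
  set K := 2 * |α| * d ^ 2 + |β| + |c| with hK
  have hK0 : 0 ≤ K := by positivity
  refine ⟨r / 2 + 2 * |α| + K / ε ^ 2 + ‖xs‖ / ε, by positivity, fun v => ?_⟩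
  set t := ‖v - xbar‖ with ht
  have ht0 : 0 ≤ t := norm_nonneg _
  by_cases hv : t < ε
  · refine le_trans ?_ (hs v hv)
    rw [hc, ← EReal.coe_add, EReal.coe_le_coe_iff]
    have : 0 ≤ (2 * |α| + K / ε ^ 2 + ‖xs‖ / ε) * t ^ 2 := by positivity
    linarith
  · push Not at hv
    refine le_trans ?_ (hb v)
    rw [EReal.coe_le_coe_iff]
    have hx : xs (v - xbar) ≤ ‖xs‖ * t := (le_abs_self _).trans (xs.le_opNorm _)
    have hlin : ‖xs‖ * t ≤ ‖xs‖ / ε * t ^ 2 := by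
      rw [div_mul_eq_mul_div, le_div_iff₀ hε]
      nlinarith [mul_le_mul_of_nonneg_left hv (mul_nonneg (norm_nonneg xs) ht0)]
    have hconst : K ≤ K / ε ^ 2 * t ^ 2 := by
      rw [div_mul_eq_mul_div, le_div_iff₀ (by positivity)]
      gcongr
    have hnorm : ‖v - x₀‖ ≤ t + d := norm_sub_le_norm_sub_add_norm_sub v xbar x₀
    have hsq : ‖v - x₀‖ ^ 2 ≤ 2 * t ^ 2 + 2 * d ^ 2 := by
      nlinarith [norm_nonneg (v - x₀), sq_nonneg (t - d)]
    have h₁ := mul_le_mul_of_nonneg_left hsq (abs_nonneg α)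
    have h₂ := mul_le_mul_of_nonneg_right (neg_abs_le α) (sq_nonneg ‖v - x₀‖)
    have h₃ := neg_abs_le β
    have h₄ := le_abs_self c
    have h₅ : 0 ≤ r / 2 * t ^ 2 := by positivity
    linarith

/-- A strict global quadratic minorant forces `xbar` to be the only minimizer. -/
theorem tiltedProx_eq_singleton_of_minorant {φ : X → EReal} (hnb : ∀ x, φ x ≠ ⊥) {xbar : X}
    {xs : X →L[ℝ] ℝ} {c M lam : ℝ} (hc : φ xbar = c) (hM : M < 1 / (2 * lam))
    (h : ∀ v : X, ((c + (xs (v - xbar) - M * ‖v - xbar‖ ^ 2) : ℝ) : EReal) ≤ φ v) :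
    TiltedProx φ xs lam xbar = {xbar} := by
  have hdiv : ∀ a : ℝ, a / (2 * lam) = 1 / (2 * lam) * a := fun a => by ring
  ext w
  simp only [TiltedProx, Set.mem_ofPred_eq, Set.mem_singleton_iff]
  constructor
  · intro hw
    have hle := hw xbar
    have hmin := h w
    rw [hc] at hle
    induction hφ : φ w using EReal.rec with
    | bot => exact absurd hφ (hnb w)
    | top =>
      rw [hφ, EReal.top_add_coe, ← EReal.coe_add, top_le_iff] at hle
      exact absurd hle (EReal.coe_ne_top _)
    | coe a =>
      rw [hφ, ← EReal.coe_add, ← EReal.coe_add, EReal.coe_le_coe_iff, hdiv] at hle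
      rw [hφ, EReal.coe_le_coe_iff, map_sub] at hmin
      simp only [sub_self, norm_zero, ne_eq, OfNat.ofNat_ne_zero, not_false_eq_true, zero_pow,
        zero_div, add_zero] at hle
      by_contra hne
      have hpos : 0 < ‖w - xbar‖ ^ 2 := pow_pos (norm_pos_iff.2 (sub_ne_zero.2 hne)) 2
      linarith [mul_lt_mul_of_pos_right hM hpos]
  · rintro rfl v
    have hmin := h v
    rw [hc]
    induction hφ : φ v using EReal.rec with
    | bot => exact absurd hφ (hnb v)
    | top => rw [EReal.top_add_coe]; exact le_top
    | coe a =>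
      rw [hφ, EReal.coe_le_coe_iff, map_sub] at hmin
      rw [← EReal.coe_add, ← EReal.coe_add, EReal.coe_le_coe_iff, hdiv (‖v - w‖ ^ 2)]
      simp only [sub_self, norm_zero, ne_eq, OfNat.ofNat_ne_zero, not_false_eq_true, zero_pow,
        zero_div, add_zero]
      linarith [mul_le_mul_of_nonneg_right hM.le (sq_nonneg ‖v - w‖)]

/-- If `xbar` is a fixed point of the tilted proximal mapping, then `φ` has a global quadratic
minorant that is exact at `xbar`. -/
theorem minorant_of_mem_tiltedProx {φ : X → EReal} (hnb : ∀ x, φ x ≠ ⊥) {xbar : X}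
    {xs : X →L[ℝ] ℝ} {c lam : ℝ} (hc : φ xbar = c) (h : xbar ∈ TiltedProx φ xs lam xbar) (v : X) :
    ((c + (xs (v - xbar) - 1 / (2 * lam) * ‖v - xbar‖ ^ 2) : ℝ) : EReal) ≤ φ v := by
  have hle := h v
  rw [hc] at hle
  induction hφ : φ v using EReal.rec with
  | bot => exact absurd hφ (hnb v)
  | top => exact le_top
  | coe a =>
    rw [hφ, ← EReal.coe_add, ← EReal.coe_add, EReal.coe_le_coe_iff] at hle
    simp only [sub_self, norm_zero, ne_eq, OfNat.ofNat_ne_zero, not_false_eq_true, zero_pow,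
      zero_div, add_zero] at hle
    rw [EReal.coe_le_coe_iff, map_sub, one_div_mul_eq_div]
    linarith

/-- A global quadratic minorant exact at `xbar` yields prox-boundedness. -/
theorem proxBounded_of_minorant {φ : X → EReal} {xbar : X} {xs : X →L[ℝ] ℝ} {c M : ℝ}
    (h : ∀ v : X, ((c + (xs (v - xbar) - M * ‖v - xbar‖ ^ 2) : ℝ) : EReal) ≤ φ v) :
    ProxBounded φ := by
  refine ⟨-(M + 1), c - ‖xs‖ ^ 2, xbar, fun v => le_trans ?_ (h v)⟩
  rw [EReal.coe_le_coe_iff]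
  have hx : -(‖xs‖ * ‖v - xbar‖) ≤ xs (v - xbar) := (abs_le.1 (xs.le_opNorm _)).1
  nlinarith [sq_nonneg (‖xs‖ - ‖v - xbar‖), sq_nonneg ‖xs‖, sq_nonneg ‖v - xbar‖]

/-- fixed points of the tilted proximal mapping. -/
theorem tiltedProx_fixed_point_characterization
    [CompleteSpace X] (φ : X → EReal) (hlsc : LowerSemicontinuous φ)
    (hnb : ∀ x, φ x ≠ ⊥) (xbar : X) (hdom : φ xbar ≠ ⊤) (xs : X →L[ℝ] ℝ) :
    ((ProxBounded φ ∧ ProximalSubgradient φ xbar xs) ↔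
      ∃ lam : ℝ, 0 < lam ∧ TiltedProx φ xs lam xbar = {xbar}) ∧
    ((ProxBounded φ ∧ ProximalSubgradient φ xbar xs) ↔
      ∃ lam₀ : ℝ, 0 < lam₀ ∧ ∀ lam : ℝ, 0 < lam → lam < lam₀ →
        TiltedProx φ xs lam xbar = {xbar}) := by
  obtain ⟨c, hc⟩ : ∃ c : ℝ, φ xbar = c :=
    ⟨(φ xbar).toReal, (EReal.coe_toReal hdom (hnb xbar)).symm⟩
  have hfwd : (ProxBounded φ ∧ ProximalSubgradient φ xbar xs) →
      ∃ lam₀ : ℝ, 0 < lam₀ ∧ ∀ lam : ℝ, 0 < lam → lam < lam₀ →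
        TiltedProx φ xs lam xbar = {xbar} := by
    rintro ⟨hb, hs⟩
    obtain ⟨M, hM, hmin⟩ := hs.exists_global_minorant hc hb
    refine ⟨1 / (2 * M), by positivity, fun lam hlam hlt =>
      tiltedProx_eq_singleton_of_minorant hnb hc ?_ hmin⟩
    rw [lt_div_iff₀ (by positivity)] at hlt ⊢
    linarith
  have hsome : (∃ lam₀ : ℝ, 0 < lam₀ ∧ ∀ lam : ℝ, 0 < lam → lam < lam₀ →
      TiltedProx φ xs lam xbar = {xbar}) →
      ∃ lam : ℝ, 0 < lam ∧ TiltedProx φ xs lam xbar = {xbar} := by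
    rintro ⟨lam₀, hpos, h⟩
    exact ⟨lam₀ / 2, half_pos hpos, h _ (half_pos hpos) (half_lt_self hpos)⟩
  have hback : (∃ lam : ℝ, 0 < lam ∧ TiltedProx φ xs lam xbar = {xbar}) →
      ProxBounded φ ∧ ProximalSubgradient φ xbar xs := by
    rintro ⟨lam, hlam, h⟩
    have hmin := minorant_of_mem_tiltedProx hnb hc (h ▸ Set.mem_singleton xbar)
    refine ⟨proxBounded_of_minorant hmin, 1 / lam, 1, by positivity, one_pos, fun v _ => ?_⟩
    have hr : 1 / lam / 2 = 1 / (2 * lam) := by ring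
    rw [hc, ← EReal.coe_add, hr]
    exact hmin v
  exact ⟨⟨fun h => hsome (hfwd h), hback⟩, ⟨hfwd, fun h => hback (hsome h)⟩⟩
end

section
/- Let X be a reflexive Banach space, φ: X → (−∞,∞] lower semicontinuous and weakly sequentially lower semicontinuous around x̄, and x̄* ∈ ∂φ(x̄). If there exist a convex neighborhood U × V of (x̄, x̄*) and ε > 0 such that every (u, u*) ∈ (U_ε × V) ∩ gph ∂φ satisfies φ(x) ≥ φ(u) + ⟨u*, x − u⟩ for all x ∈ U, then φ is variationally convex at x̄ for x̄*. -/
open Filter Topology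

variable {X : Type*} [NormedAddCommGroup X] [NormedSpace ℝ X]

/-- The Fréchet `ε`-subdifferential of `φ` at `x`. -/
def EpsSubdiff (φ : X → EReal) (ε : ℝ) (x : X) : Set (X →L[ℝ] ℝ) :=
  {xs | ∀ η : ℝ, 0 < η → ∃ δ : ℝ, 0 < δ ∧ ∀ y : X, ‖y - x‖ < δ →
    φ x + ((xs (y - x) - (ε + η) * ‖y - x‖ : ℝ) : EReal) ≤ φ y}

/-- The limiting (Mordukhovich) subdifferential of `φ` at `xbar`:
sequential outer limit (with weak* convergence of subgradients) of
`ε`-subdifferentials along `φ`-attentive convergence. -/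
def LimitingSubdiff (φ : X → EReal) (xbar : X) : Set (X →L[ℝ] ℝ) :=
  {xs | ∃ (xk : ℕ → X) (xsk : ℕ → X →L[ℝ] ℝ) (εk : ℕ → ℝ),
    (∀ k, 0 ≤ εk k) ∧ Tendsto εk atTop (𝓝 0) ∧
    Tendsto xk atTop (𝓝 xbar) ∧
    Tendsto (fun k => φ (xk k)) atTop (𝓝 (φ xbar)) ∧
    (∀ k, xsk k ∈ EpsSubdiff φ (εk k) (xk k)) ∧
    (∀ v : X, Tendsto (fun k => xsk k v) atTop (𝓝 (xs v)))}

/-- The convex-analysis subdifferential of an extended-real-valued function. -/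
def ConvexSubdiff (ψ : X → EReal) (x : X) : Set (X →L[ℝ] ℝ) :=
  {xs | ∀ y : X, ψ x + ((xs (y - x) : ℝ) : EReal) ≤ ψ y}

/-- Convexity of an `EReal`-valued function on a set. -/
def ERealConvexOn (s : Set X) (ψ : X → EReal) : Prop :=
  ∀ x ∈ s, ∀ y ∈ s, ∀ t : ℝ, 0 ≤ t → t ≤ 1 →
    ψ (t • x + (1 - t) • y) ≤ (t : EReal) * ψ x + ((1 - t : ℝ) : EReal) * ψ y

/-- Rockafellar's variational convexity of `φ` at `xbar` for
`xs ∈ ∂φ(xbar)`. -/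
def VariationallyConvexAt (φ : X → EReal) (xbar : X) (xs : X →L[ℝ] ℝ) : Prop :=
  ∃ (U : Set X) (V : Set (X →L[ℝ] ℝ)),
    IsOpen U ∧ Convex ℝ U ∧ xbar ∈ U ∧ IsOpen V ∧ Convex ℝ V ∧ xs ∈ V ∧
    ∃ (φhat : X → EReal) (ε : ℝ), 0 < ε ∧
      ERealConvexOn Set.univ φhat ∧ LowerSemicontinuous φhat ∧
      (∀ x ∈ U, φhat x ≤ φ x) ∧
      (∀ (x : X) (v : X →L[ℝ] ℝ),
        (x ∈ U ∧ φ x < φ xbar + (ε : EReal) ∧ v ∈ V ∧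
            v ∈ LimitingSubdiff φ x) ↔
        (x ∈ U ∧ v ∈ V ∧ v ∈ ConvexSubdiff φhat x)) ∧
      (∀ (x : X) (v : X →L[ℝ] ℝ),
        x ∈ U ∧ v ∈ V ∧ v ∈ ConvexSubdiff φhat x → φ x = φhat x)

/-- `φ` is weakly sequentially lower semicontinuous at every point of some
neighborhood of `xbar`. -/
def WeaklySeqLscAround (φ : X → EReal) (xbar : X) : Prop :=
  ∃ δ : ℝ, 0 < δ ∧ ∀ x : X, ‖x - xbar‖ < δ →
    ∀ xk : ℕ → X,
      (∀ f : X →L[ℝ] ℝ, Tendsto (fun k => f (xk k)) atTop (𝓝 (f x))) →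
      φ x ≤ Filter.liminf (fun k => φ (xk k)) atTop

/-- A sequence can be built by choosing each term from the truncation of the sequence at it. -/
lemma exists_seq_of_truncation {α : Type*} (d : α) (P : ℕ → (ℕ → α) → α → Prop)
    (hP : ∀ n s, ∃ a, P n s a) :
    ∃ s : ℕ → α, ∀ n, P n (fun k => if k < n then s k else d) (s n) := by
  choose c hc using hP
  let F : (n : ℕ) → ((m : ℕ) → m < n → α) → α := fun n s =>
    c n (fun k => if h : k < n then s k h else d)
  let s : ℕ → α := fun n => WellFounded.fix (C := fun _ => α) Nat.lt_wfRel.wf F n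
  have hs : ∀ n, s n = c n (fun k => if k < n then s k else d) := by
    intro n
    change WellFounded.fix _ F n = _
    rw [WellFounded.fix_eq]
    simp only [F, dite_eq_ite]
    rfl
  exact ⟨s, fun n => by rw [hs n]; exact hc _ _⟩

/-- A closed set containing the midpoint of any two of its points is convex. -/
lemma IsClosed.convex_of_midpoint_mem {E : Type*} [NormedAddCommGroup E] [NormedSpace ℝ E]
    {S : Set E} (hS : IsClosed S)
    (hmid : ∀ x ∈ S, ∀ y ∈ S, midpoint ℝ x y ∈ S) : Convex ℝ S := by
  rw [convex_iff_segment_subset]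
  intro x hx y hy
  rw [segment_eq_image_lineMap]
  rintro _ ⟨t, ht, rfl⟩
  by_contra hns
  let T : Set ℝ := (AffineMap.lineMap x y : ℝ → E) ⁻¹' S
  have hT : IsClosed T := hS.preimage AffineMap.lineMap_continuous
  have h0 : (0 : ℝ) ∈ T := by simpa [T] using hx
  have h1 : (1 : ℝ) ∈ T := by simpa [T] using hy
  have hA : IsCompact (T ∩ Set.Icc 0 t) := isCompact_Icc.inter_left hT
  have hB : IsCompact (T ∩ Set.Icc t 1) := isCompact_Icc.inter_left hT
  obtain ⟨a, ⟨haT, ha⟩, hamax⟩ := hA.exists_isGreatest ⟨0, h0, le_rfl, ht.1⟩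
  obtain ⟨b, ⟨hbT, hb⟩, hbmin⟩ := hB.exists_isLeast ⟨1, h1, ht.2, le_rfl⟩
  have hat : a ≠ t := by rintro rfl; exact hns haT
  have hbt : b ≠ t := by rintro rfl; exact hns hbT
  have hat' : a < t := lt_of_le_of_ne ha.2 hat
  have hbt' : t < b := lt_of_le_of_ne hb.1 hbt.symm
  have hm : midpoint ℝ a b ∈ T := by
    have := hmid _ haT _ hbT
    change AffineMap.lineMap x y (midpoint ℝ a b) ∈ S
    rwa [AffineMap.map_midpoint]
  have hme : midpoint ℝ a b = (a + b) / 2 := by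
    rw [midpoint_eq_smul_add]; simp; ring
  rw [hme] at hm
  rcases le_total ((a + b) / 2) t with h | h
  · have := hamax ⟨hm, by linarith [ha.1], h⟩
    linarith
  · have := hbmin ⟨hm, h, by linarith [hb.2]⟩
    linarith

/-- A closed convex set contains the weak limits of its points. -/
lemma Convex.mem_of_tendsto_weak {ι : Type*} {l : Filter ι} [l.NeBot] {S : Set X}
    (hc : Convex ℝ S) (hS : IsClosed S) {x : ι → X} {a : X} (hx : ∀ᶠ i in l, x i ∈ S)
    (ha : ∀ f : X →L[ℝ] ℝ, Tendsto (fun i => f (x i)) l (𝓝 (f a))) : a ∈ S := by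
  by_contra h
  obtain ⟨f, c, hf, hc'⟩ := geometric_hahn_banach_closed_point hc hS h
  exact hc'.not_ge (le_of_tendsto (ha f) (hx.mono fun i hi => (hf _ hi).le))

/-- In a reflexive space, bounded families converge weakly along ultrafilters. -/
lemma exists_weak_limit_ultrafilter
    (hrefl : Function.Surjective (NormedSpace.inclusionInDoubleDual ℝ X))
    {ι : Type*} (l : Ultrafilter ι) {x : ι → X} {R : ℝ} (hx : ∀ i, ‖x i‖ ≤ R) :
    ∃ a : X, ∀ f : X →L[ℝ] ℝ, Tendsto (fun i => f (x i)) l (𝓝 (f a)) := by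
  have hK := WeakDual.isCompact_closedBall (𝕜 := ℝ) (E := X →L[ℝ] ℝ) 0 R
  let w : ι → WeakDual ℝ (X →L[ℝ] ℝ) := fun i =>
    StrongDual.toWeakDual (NormedSpace.inclusionInDoubleDual ℝ X (x i))
  obtain ⟨ξ, -, hξ⟩ := hK.ultrafilter_le_nhds (l.map w) (by
    rw [le_principal_iff]
    refine Filter.mem_map.2 (Filter.univ_mem' fun i => ?_)
    have := (NormedSpace.double_dual_bound ℝ X (x i)).trans (hx i)
    simpa [w] using this)
  obtain ⟨a, ha⟩ := hrefl (WeakDual.toStrongDual ξ)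
  refine ⟨a, fun f => ?_⟩
  have h := ((WeakDual.eval_continuous f).tendsto ξ).comp (show Tendsto w l (𝓝 ξ) from hξ)
  have h2 : ξ f = f a := by
    rw [← NormedSpace.dual_def ℝ X a f, ha]; rfl
  rw [← h2]
  exact h

/-- In a reflexive space, bounded sequences have weakly convergent subsequences. -/
lemma exists_weakly_convergent_subseq
    (hrefl : Function.Surjective (NormedSpace.inclusionInDoubleDual ℝ X))
    {x : ℕ → X} {R : ℝ} (hx : ∀ i, ‖x i‖ ≤ R) :
    ∃ (a : X) (σ : ℕ → ℕ), StrictMono σ ∧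
      ∀ f : X →L[ℝ] ℝ, Tendsto (fun i => f (x (σ i))) atTop (𝓝 (f a)) := by
  let Y : Set X := closure (Submodule.span ℝ (Set.range x) : Set X)
  have hYc : Convex ℝ Y := (Submodule.span ℝ (Set.range x)).convex.closure
  have hYsub : ∀ p ∈ Y, ∀ q ∈ Y, p - q ∈ Y := fun p hp q hq =>
    (Submodule.span ℝ (Set.range x)).topologicalClosure.sub_mem hp hq
  have hsep : TopologicalSpace.IsSeparable Y :=
    ((Set.countable_range x).isSeparable.span (R := ℝ)).closure
  obtain ⟨D, hDY, hDc, hYD⟩ := hsep.exists_countable_dense_subset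
  have hDne : D.Nonempty := by
    by_contra h
    rw [Set.not_nonempty_iff_eq_empty] at h
    have := hYD (subset_closure (zero_mem (Submodule.span ℝ (Set.range x))))
    simp [h] at this
  obtain ⟨d, hd⟩ := hDc.exists_eq_range hDne
  choose f hf hfd using fun i => exists_dual_vector'' ℝ (d i)
  have hf0 : ∀ y ∈ Y, (∀ i, f i y = 0) → y = 0 := by
    intro y hy h0
    by_contra hne
    have hpos : 0 < ‖y‖ := norm_pos_iff.2 hne
    obtain ⟨_, hz, hyz⟩ := Metric.mem_closure_iff.1 (hYD hy) (‖y‖ / 2) (by positivity)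
    rw [hd] at hz
    obtain ⟨i, rfl⟩ := hz
    rw [dist_eq_norm] at hyz
    have h1 : ‖d i‖ ≤ ‖y - d i‖ := by
      have h2 := (f i).le_of_opNorm_le (hf i) (d i - y)
      rw [map_sub, h0 i, hfd i, sub_zero, one_mul, norm_sub_rev] at h2
      simpa using h2
    have h3 := norm_le_norm_add_norm_sub' y (d i)
    linarith
  have hcpt : IsCompact (Set.univ.pi fun _ : ℕ => Set.Icc (-R) R) :=
    isCompact_univ_pi fun _ => isCompact_Icc
  obtain ⟨c, -, σ, hσ, hc⟩ := hcpt.tendsto_subseq (x := fun n i => f i (x n)) (by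
    intro n i _
    have := (f i).le_of_opNorm_le (hf i) (x n)
    rw [one_mul] at this
    exact abs_le.1 (this.trans (hx n)))
  rw [tendsto_pi_nhds] at hc
  have key : ∀ l : Ultrafilter ℕ, (l : Filter ℕ) ≤ atTop → ∃ a ∈ Y, (∀ i, f i a = c i) ∧
      ∀ g : X →L[ℝ] ℝ, Tendsto (fun n => g (x (σ n))) l (𝓝 (g a)) := by
    intro l hl
    obtain ⟨a, ha⟩ := exists_weak_limit_ultrafilter hrefl l (fun n => hx (σ n))
    refine ⟨a, hYc.mem_of_tendsto_weak isClosed_closure (Eventually.of_forall fun n =>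
      subset_closure (Submodule.subset_span ⟨σ n, rfl⟩)) ha, fun i => ?_, ha⟩
    exact tendsto_nhds_unique (ha (f i)) ((hc i).mono_left hl)
  obtain ⟨a, haY, hac, -⟩ := key (hyperfilter ℕ) Nat.hyperfilter_le_atTop
  refine ⟨a, σ, hσ, fun g => ?_⟩
  rw [tendsto_iff_ultrafilter]
  intro l hl
  obtain ⟨b, hbY, hbc, hb⟩ := key l hl
  have : b - a = 0 := hf0 _ (hYsub b hbY a haY) fun i => by rw [map_sub, hbc, hac, sub_self]
  rw [sub_eq_zero] at this
  exact this ▸ hb g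

/-- In the dual of a reflexive space, a decreasing sequence of nonempty bounded closed convex
sets has a common point. -/
lemma exists_mem_of_antitone_closed_convex
    (hrefl : Function.Surjective (NormedSpace.inclusionInDoubleDual ℝ X))
    {S : ℕ → Set (X →L[ℝ] ℝ)} {R : ℝ} (hanti : Antitone S) (hne : ∀ n, (S n).Nonempty)
    (hc : ∀ n, Convex ℝ (S n)) (hcl : ∀ n, IsClosed (S n)) (hb : ∀ n, ∀ w ∈ S n, ‖w‖ ≤ R) :
    ∃ j, ∀ n, j ∈ S n := by
  choose w hw using hne
  have hK := WeakDual.isCompact_closedBall (𝕜 := ℝ) (E := X) 0 R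
  obtain ⟨ξ, -, hξ⟩ := hK.ultrafilter_le_nhds
    ((hyperfilter ℕ).map fun n => StrongDual.toWeakDual (w n)) (by
      rw [le_principal_iff]
      refine Filter.mem_map.2 (Filter.univ_mem' fun n => ?_)
      simpa using hb n _ (hw n))
  refine ⟨WeakDual.toStrongDual ξ, fun n => ?_⟩
  refine (hc n).mem_of_tendsto_weak (l := (hyperfilter ℕ : Filter ℕ)) (hcl n) (x := w) ?_ ?_
  · exact Nat.hyperfilter_le_atTop
      ((eventually_ge_atTop n).mono fun m hm => hanti hm (hw m))
  · intro F
    obtain ⟨a, rfl⟩ := hrefl F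
    exact ((WeakDual.eval_continuous a).tendsto ξ).comp
      (show Tendsto (fun n => StrongDual.toWeakDual (w n)) (hyperfilter ℕ) (𝓝 ξ) from hξ)

/-- The function `y ↦ sup (w y - P w)`, the supremum being over the dual ball of radius `s`. -/
noncomputable def dualPenalty (s : ℝ) (P : (X →L[ℝ] ℝ) → ℝ) (y : X) : ℝ :=
  sSup ((fun w : X →L[ℝ] ℝ => w y - P w) '' Metric.closedBall 0 s)

section DualPenalty

variable {s : ℝ} {P Q : (X →L[ℝ] ℝ) → ℝ}

lemma dualPenalty_le (hs : 0 ≤ s) {y : X} {c : ℝ} (h : ∀ w : X →L[ℝ] ℝ, ‖w‖ ≤ s → w y - P w ≤ c) :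
    dualPenalty s P y ≤ c := by
  refine csSup_le ((Metric.nonempty_closedBall.2 hs).image _) ?_
  rintro _ ⟨w, hw, rfl⟩
  exact h w (mem_closedBall_zero_iff.1 hw)

lemma le_dualPenalty (hP : ∀ w, 0 ≤ P w) {w : X →L[ℝ] ℝ} (hw : ‖w‖ ≤ s) (y : X) :
    w y - P w ≤ dualPenalty s P y := by
  refine le_csSup ⟨s * ‖y‖, ?_⟩ ⟨w, mem_closedBall_zero_iff.2 hw, rfl⟩
  rintro _ ⟨v, hv, rfl⟩
  have := (le_abs_self _).trans (v.le_of_opNorm_le (mem_closedBall_zero_iff.1 hv) y)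
  have := hP v
  dsimp only
  linarith

lemma exists_dualPenalty_le_add (hs : 0 ≤ s) (y : X) {θ : ℝ} (hθ : 0 < θ) :
    ∃ w : X →L[ℝ] ℝ, ‖w‖ ≤ s ∧ dualPenalty s P y ≤ w y - P w + θ := by
  obtain ⟨_, ⟨w, hw, rfl⟩, h⟩ := exists_lt_of_lt_csSup
    ((Metric.nonempty_closedBall.2 hs).image (fun w : X →L[ℝ] ℝ => w y - P w))
    (show dualPenalty s P y - θ < sSup _ by unfold dualPenalty; linarith)
  exact ⟨w, mem_closedBall_zero_iff.1 hw, by dsimp only at h; linarith⟩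

lemma dualPenalty_le_mul_norm (hs : 0 ≤ s) (hP : ∀ w, 0 ≤ P w) (y : X) :
    dualPenalty s P y ≤ s * ‖y‖ :=
  dualPenalty_le hs fun w hw => by
    have := (le_abs_self _).trans (w.le_of_opNorm_le hw y)
    have := hP w
    linarith

lemma mul_norm_sub_le_dualPenalty (hs : 0 ≤ s) (hP : ∀ w, 0 ≤ P w) {η : ℝ}
    (hη : ∀ w, ‖w‖ ≤ s → P w ≤ η) (y : X) : s * ‖y‖ - η ≤ dualPenalty s P y := by
  obtain ⟨w, hw, hwy⟩ := exists_dual_vector'' ℝ y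
  have hsw : ‖s • w‖ ≤ s := by
    rw [norm_smul, Real.norm_of_nonneg hs]
    exact mul_le_of_le_one_right hs hw
  have h1 := le_dualPenalty hP hsw y
  have h2 := hη _ hsw
  simp only [smul_apply, hwy, smul_eq_mul, RCLike.ofReal_real_eq_id, id_eq]
    at h1
  linarith

lemma dualPenalty_le_add_mul_norm_sub (hs : 0 ≤ s) (hP : ∀ w, 0 ≤ P w) (y y' : X) :
    dualPenalty s P y ≤ dualPenalty s P y' + s * ‖y - y'‖ :=
  dualPenalty_le hs fun w hw => by
    have h1 := (le_abs_self _).trans (w.le_of_opNorm_le hw (y - y'))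
    have h2 := le_dualPenalty hP hw y'
    rw [map_sub] at h1
    linarith

lemma dualPenalty_le_dualPenalty_add (hs : 0 ≤ s) (hQ : ∀ w, 0 ≤ Q w) {τ : ℝ}
    (h : ∀ w, ‖w‖ ≤ s → Q w ≤ P w + τ) (y : X) :
    dualPenalty s P y ≤ dualPenalty s Q y + τ :=
  dualPenalty_le hs fun w hw => by
    have h1 := le_dualPenalty hQ hw y
    have := h w hw
    linarith

end DualPenalty

/-- Weighted sum of squared distances to the first `n` terms of `z`. -/
noncomputable def sqDistSum (a : ℕ → ℝ) (z : ℕ → X →L[ℝ] ℝ) (n : ℕ) (w : X →L[ℝ] ℝ) : ℝ :=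
  ∑ k ∈ Finset.range n, a k * ‖w - z k‖ ^ 2

/-- Weighted sum of squared distances to the terms of `z`. -/
noncomputable def sqDistTsum (a : ℕ → ℝ) (z : ℕ → X →L[ℝ] ℝ) (w : X →L[ℝ] ℝ) : ℝ :=
  ∑' k, a k * ‖w - z k‖ ^ 2

lemma norm_midpoint_sub_sq_le {E : Type*} [NormedAddCommGroup E] [NormedSpace ℝ E] (u v c : E) :
    ‖midpoint ℝ u v - c‖ ^ 2 + (‖u - c‖ - ‖v - c‖) ^ 2 / 4 ≤ (‖u - c‖ ^ 2 + ‖v - c‖ ^ 2) / 2 := by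
  have h : ‖midpoint ℝ u v - c‖ ≤ (‖u - c‖ + ‖v - c‖) / 2 := by
    have : midpoint ℝ u v - c = (1 / 2 : ℝ) • ((u - c) + (v - c)) := by
      rw [midpoint_eq_smul_add, invOf_eq_inv]
      module
    rw [this, norm_smul]
    have := norm_add_le (u - c) (v - c)
    norm_num
    linarith
  nlinarith [norm_nonneg (midpoint ℝ u v - c), norm_nonneg (u - c), norm_nonneg (v - c)]

section SqDist

variable {a : ℕ → ℝ} {z : ℕ → X →L[ℝ] ℝ} {s η : ℝ}

lemma sqDistSum_nonneg (ha : ∀ k, 0 ≤ a k) (n : ℕ) (w : X →L[ℝ] ℝ) : 0 ≤ sqDistSum a z n w :=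
  Finset.sum_nonneg fun k _ => mul_nonneg (ha k) (sq_nonneg _)

lemma sqDistTsum_nonneg (ha : ∀ k, 0 ≤ a k) (w : X →L[ℝ] ℝ) : 0 ≤ sqDistTsum a z w :=
  tsum_nonneg fun k => mul_nonneg (ha k) (sq_nonneg _)

lemma sqDistSum_congr {z' : ℕ → X →L[ℝ] ℝ} {n : ℕ} (h : ∀ k < n, z k = z' k) :
    sqDistSum a z n = sqDistSum a z' n := by
  funext w
  exact Finset.sum_congr rfl fun k hk => by rw [h k (Finset.mem_range.1 hk)]

lemma continuous_sqDistSum (n : ℕ) : Continuous (sqDistSum a z n) := by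
  unfold sqDistSum
  fun_prop

lemma sqDistSum_midpoint_le (ha : ∀ k, 0 ≤ a k) (n : ℕ) (u v : X →L[ℝ] ℝ) :
    sqDistSum a z n (midpoint ℝ u v) ≤ (sqDistSum a z n u + sqDistSum a z n v) / 2 := by
  unfold sqDistSum
  rw [← Finset.sum_add_distrib, Finset.sum_div]
  refine Finset.sum_le_sum fun k _ => ?_
  have := norm_midpoint_sub_sq_le u v (z k)
  nlinarith [ha k, sq_nonneg (‖u - z k‖ - ‖v - z k‖)]

lemma sq_norm_sub_le (hz : ∀ k, ‖z k‖ ≤ s) {w : X →L[ℝ] ℝ} (hw : ‖w‖ ≤ s) (k : ℕ) :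
    ‖w - z k‖ ^ 2 ≤ 4 * s ^ 2 := by
  have := norm_sub_le w (z k)
  have := hz k
  nlinarith [norm_nonneg (w - z k)]

lemma summable_sqDist (ha : ∀ k, 0 ≤ a k) (has : Summable a) (hz : ∀ k, ‖z k‖ ≤ s)
    {w : X →L[ℝ] ℝ} (hw : ‖w‖ ≤ s) : Summable fun k => a k * ‖w - z k‖ ^ 2 :=
  (has.mul_right (4 * s ^ 2)).of_nonneg_of_le (fun k => mul_nonneg (ha k) (sq_nonneg _))
    fun k => mul_le_mul_of_nonneg_left (sq_norm_sub_le hz hw k) (ha k)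

lemma sqDistSum_le_sqDistTsum (ha : ∀ k, 0 ≤ a k) (has : Summable a) (hz : ∀ k, ‖z k‖ ≤ s)
    (n : ℕ) {w : X →L[ℝ] ℝ} (hw : ‖w‖ ≤ s) : sqDistSum a z n w ≤ sqDistTsum a z w :=
  (summable_sqDist ha has hz hw).sum_le_tsum _ fun k _ => mul_nonneg (ha k) (sq_nonneg _)

lemma sqDistTsum_le (ha : ∀ k, 0 ≤ a k) (has : Summable a) (hz : ∀ k, ‖z k‖ ≤ s)
    (n : ℕ) {w : X →L[ℝ] ℝ} (hw : ‖w‖ ≤ s) :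
    sqDistTsum a z w ≤ sqDistSum a z n w + (∑' k, a (k + n)) * (4 * s ^ 2) := by
  have hsum := summable_sqDist ha has hz hw
  unfold sqDistTsum sqDistSum
  rw [← hsum.sum_add_tsum_nat_add n, ← tsum_mul_right]
  refine add_le_add le_rfl (Summable.tsum_le_tsum (fun k => ?_)
    ((summable_nat_add_iff n).2 hsum) (((summable_nat_add_iff n).2 has).mul_right _))
  exact mul_le_mul_of_nonneg_left (sq_norm_sub_le hz hw _) (ha _)

lemma sqDistTsum_midpoint_add_le (ha : ∀ k, 0 ≤ a k) (has : Summable a) (hz : ∀ k, ‖z k‖ ≤ s)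
    {u v : X →L[ℝ] ℝ} (hu : ‖u‖ ≤ s) (hv : ‖v‖ ≤ s) (k : ℕ) :
    sqDistTsum a z (midpoint ℝ u v) + a k * (‖u - z k‖ - ‖v - z k‖) ^ 2 / 4 ≤
      (sqDistTsum a z u + sqDistTsum a z v) / 2 := by
  have hm : ‖midpoint ℝ u v‖ ≤ s := by
    have := (convex_closedBall (0 : X →L[ℝ] ℝ) s).midpoint_mem
      (mem_closedBall_zero_iff.2 hu) (mem_closedBall_zero_iff.2 hv)
    exact mem_closedBall_zero_iff.1 this
  have hSu := summable_sqDist ha has hz hu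
  have hSv := summable_sqDist ha has hz hv
  have hSm := summable_sqDist ha has hz hm
  have hS := ((hSu.add hSv).div_const 2).sub hSm
  have h1 : (a k * ‖u - z k‖ ^ 2 + a k * ‖v - z k‖ ^ 2) / 2 - a k * ‖midpoint ℝ u v - z k‖ ^ 2 ≤
      ∑' k, ((a k * ‖u - z k‖ ^ 2 + a k * ‖v - z k‖ ^ 2) / 2 -
        a k * ‖midpoint ℝ u v - z k‖ ^ 2) := by
    refine hS.le_tsum k fun i _ => ?_
    have := norm_midpoint_sub_sq_le u v (z i)
    nlinarith [ha i, sq_nonneg (‖u - z i‖ - ‖v - z i‖)]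
  rw [((hSu.add hSv).div_const 2).tsum_sub hSm, tsum_div_const, hSu.tsum_add hSv] at h1
  have h2 := mul_le_mul_of_nonneg_left (norm_midpoint_sub_sq_le u v (z k)) (ha k)
  unfold sqDistTsum
  linarith

end SqDist

/-- Simultaneous construction of almost minimizers `y (2 * m)` of `f` plus a penalty defined by
`z` on indices below `2 * m`, and of almost maximizers `z (2 * m)` in the definition of the penalty
at earlier points of `y`. Both sequences are closed under midpoints. -/
lemma exists_minimizing_seq {A : Set X} {f : X → ℝ} {s : ℝ} {a τ : ℕ → ℝ} (hs : 0 ≤ s)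
    (ha : ∀ k, 0 ≤ a k) (hτ : ∀ n, 0 < τ n) (hA : A.Nonempty) (hf : ∀ x ∈ A, 0 ≤ f x) :
    ∃ (y : ℕ → X) (z : ℕ → X →L[ℝ] ℝ), (∀ k, ‖z k‖ ≤ s) ∧
      (∀ m, y (2 * m) ∈ A ∧ ∀ v ∈ A,
        f (y (2 * m)) + dualPenalty s (sqDistSum a z (2 * m)) (y (2 * m)) ≤
          f v + dualPenalty s (sqDistSum a z (2 * m)) v + τ (2 * m)) ∧
      (∀ m, 1 ≤ m → dualPenalty s (sqDistSum a z (2 * m)) (y m.unpair.1) ≤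
        z (2 * m) (y m.unpair.1) - sqDistSum a z (2 * m) (z (2 * m)) + τ (2 * m)) ∧
      (∀ i k, ∃ n, y n = midpoint ℝ (y i) (y k) ∧ z n = midpoint ℝ (z i) (z k)) := by
  obtain ⟨q, hq⟩ := exists_seq_of_truncation (0 : X × (X →L[ℝ] ℝ)) (fun n t p =>
    ((∀ k, ‖(t k).2‖ ≤ s) → ‖p.2‖ ≤ s) ∧
    (∀ m, n = 2 * m →
      (p.1 ∈ A ∧ ∀ v ∈ A,
        f p.1 + dualPenalty s (sqDistSum a (fun k => (t k).2) n) p.1 ≤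
          f v + dualPenalty s (sqDistSum a (fun k => (t k).2) n) v + τ n) ∧
      dualPenalty s (sqDistSum a (fun k => (t k).2) n) (t m.unpair.1).1 ≤
        p.2 (t m.unpair.1).1 - sqDistSum a (fun k => (t k).2) n p.2 + τ n) ∧
    (∀ m, n = 2 * m + 1 → p = midpoint ℝ (t m.unpair.1) (t m.unpair.2))) (by
      intro n t
      rcases Nat.even_or_odd' n with ⟨m, rfl | rfl⟩
      · set P := sqDistSum a (fun k => (t k).2) (2 * m)
        have hP : ∀ w, 0 ≤ P w := sqDistSum_nonneg ha _
        obtain ⟨w, hw, hw'⟩ := exists_dualPenalty_le_add (P := P) hs (t m.unpair.1).1 (hτ (2 * m))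
        have hbdd : BddBelow ((fun v => f v + dualPenalty s P v) '' A) := by
          refine ⟨-P 0, ?_⟩
          rintro _ ⟨v, hv, rfl⟩
          have h1 := le_dualPenalty hP (w := 0) (by simpa using hs) v
          have h2 := hf v hv
          simp only [zero_apply, zero_sub] at h1
          dsimp only
          linarith
        obtain ⟨_, ⟨x, hx, rfl⟩, hlt⟩ := exists_lt_of_csInf_lt
          (hA.image (fun v => f v + dualPenalty s P v))
          (lt_add_of_pos_right _ (hτ (2 * m)))
        refine ⟨(x, w), fun _ => hw, fun m' hm' => ?_, fun m' hm' => by omega⟩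
        obtain rfl : m' = m := by omega
        refine ⟨⟨hx, fun v hv => ?_⟩, hw'⟩
        have := csInf_le hbdd ⟨v, hv, rfl⟩
        dsimp only at this hlt ⊢
        linarith
      · refine ⟨midpoint ℝ (t m.unpair.1) (t m.unpair.2), fun ht => ?_,
          fun m' hm' => by omega, fun m' hm' => ?_⟩
        · have := (convex_closedBall (0 : X →L[ℝ] ℝ) s).midpoint_mem
            (mem_closedBall_zero_iff.2 (ht m.unpair.1)) (mem_closedBall_zero_iff.2 (ht m.unpair.2))
          exact mem_closedBall_zero_iff.1 this
        · obtain rfl : m' = m := by omega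
          rfl)
  beta_reduce at hq
  have hz : ∀ n, ‖(q n).2‖ ≤ s := by
    intro n
    induction n using Nat.strong_induction_on with
    | _ n ih =>
      refine (hq n).1 fun k => ?_
      split_ifs with h
      · exact ih k h
      · simpa using hs
  have htr : ∀ n, sqDistSum a (fun k => (if k < n then q k else 0).2) n =
      sqDistSum a (fun k => (q k).2) n := fun n =>
    sqDistSum_congr fun k hk => by rw [if_pos hk]
  refine ⟨fun n => (q n).1, fun n => (q n).2, hz, fun m => ?_, fun m hm => ?_, fun i k => ?_⟩
  · have := ((hq (2 * m)).2.1 m rfl).1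
    rwa [htr] at this
  · have := ((hq (2 * m)).2.1 m rfl).2
    rwa [htr, if_pos (by have := m.unpair_left_le; omega)] at this
  · have h := (hq (2 * Nat.pair i k + 1)).2.2 _ rfl
    rw [Nat.unpair_pair, if_pos (by have := Nat.left_le_pair i k; omega),
      if_pos (by have := Nat.right_le_pair i k; omega)] at h
    exact ⟨2 * Nat.pair i k + 1, congrArg Prod.fst h, congrArg Prod.snd h⟩

/-- If the supremum defining the penalty of `sqDistTsum a z` at `x` is approached along `z`, and
the range of `z` is closed under midpoints, then the penalty is Fréchet superdifferentiable
at `x`, the supremum being attained at the supergradient. -/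
lemma exists_supergradient_dualPenalty
    (hrefl : Function.Surjective (NormedSpace.inclusionInDoubleDual ℝ X))
    {s : ℝ} {a : ℕ → ℝ} {z : ℕ → X →L[ℝ] ℝ} (hs : 0 < s) (ha : ∀ k, 0 < a k) (has : Summable a)
    (hz : ∀ k, ‖z k‖ ≤ s) (hzmid : ∀ i k, ∃ n, z n = midpoint ℝ (z i) (z k)) {x : X}
    (hx : ∀ θ > 0, ∃ k, dualPenalty s (sqDistTsum a z) x ≤ z k x - sqDistTsum a z (z k) + θ) :
    ∃ j : X →L[ℝ] ℝ, ‖j‖ ≤ s ∧ dualPenalty s (sqDistTsum a z) x ≤ j x ∧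
      ∀ θ > 0, ∃ δ > 0, ∀ h : X, ‖h‖ < δ →
        dualPenalty s (sqDistTsum a z) (x + h) ≤
          dualPenalty s (sqDistTsum a z) x + j h + θ * ‖h‖ := by
  have ha' : ∀ k, 0 ≤ a k := fun k => (ha k).le
  set P := sqDistTsum a z with hPdef
  have hP : ∀ w, 0 ≤ P w := sqDistTsum_nonneg ha'
  set D : Set (X →L[ℝ] ℝ) := closure (Set.range z)
  have hDmid : ∀ u ∈ D, ∀ v ∈ D, midpoint ℝ u v ∈ D := by
    intro u hu v hv
    refine map_mem_closure₂ (f := fun u v => midpoint ℝ u v) (by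
      simp only [midpoint_eq_smul_add]; fun_prop) hu hv ?_
    rintro _ ⟨i, rfl⟩ _ ⟨k, rfl⟩
    obtain ⟨n, hn⟩ := hzmid i k
    exact ⟨n, hn⟩
  have hDs : ∀ u ∈ D, ‖u‖ ≤ s := by
    intro u hu
    have : D ⊆ Metric.closedBall 0 s := closure_minimal (by
      rintro _ ⟨k, rfl⟩; exact mem_closedBall_zero_iff.2 (hz k)) Metric.isClosed_closedBall
    exact mem_closedBall_zero_iff.1 (this hu)
  let S : ℕ → Set (X →L[ℝ] ℝ) := fun i =>
    {w | w ∈ D ∧ ∀ n, dualPenalty s P x ≤ w x - sqDistSum a z n w + (1 / ((i : ℝ) + 1))}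
  have hScl : ∀ i, IsClosed (S i) := by
    intro i
    simp only [S, Set.ofPred_and, Set.ofPred_forall]
    refine isClosed_closure.inter (isClosed_iInter fun n => ?_)
    have := continuous_sqDistSum (a := a) (z := z) n
    exact isClosed_le continuous_const (by fun_prop)
  have hSc : ∀ i, Convex ℝ (S i) := by
    intro i
    refine (hScl i).convex_of_midpoint_mem fun u hu v hv => ⟨hDmid u hu.1 v hv.1, fun n => ?_⟩
    have h1 := sqDistSum_midpoint_le (z := z) ha' n u v
    have h2 : (midpoint ℝ u v) x = (u x + v x) / 2 := by
      rw [midpoint_eq_smul_add, invOf_eq_inv]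
      simp only [smul_apply, add_apply, smul_eq_mul]
      ring
    have := hu.2 n
    have := hv.2 n
    rw [h2]
    linarith
  obtain ⟨j, hj⟩ := exists_mem_of_antitone_closed_convex hrefl (S := S) (R := s)
    (fun i k hik w hw => ⟨hw.1, fun n => (hw.2 n).trans (by
      gcongr)⟩)
    (fun i => by
      obtain ⟨k, hk⟩ := hx (1 / ((i : ℝ) + 1)) (by positivity)
      refine ⟨z k, subset_closure ⟨k, rfl⟩, fun n => ?_⟩
      have := sqDistSum_le_sqDistTsum ha' has hz n (hz k)
      linarith)
    hSc hScl (fun i w hw => hDs w hw.1)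
  have hjD : j ∈ D := (hj 0).1
  have hjs := hDs j hjD
  have hjmax : dualPenalty s P x ≤ j x - P j := by
    have h1 : ∀ n, dualPenalty s P x ≤ j x - sqDistSum a z n j := by
      intro n
      have h2 : Tendsto (fun i : ℕ => j x - sqDistSum a z n j + 1 / ((i : ℝ) + 1)) atTop
          (𝓝 (j x - sqDistSum a z n j + 0)) :=
        tendsto_const_nhds.add tendsto_one_div_add_atTop_nhds_zero_nat
      rw [add_zero] at h2
      exact ge_of_tendsto' h2 fun i => (hj i).2 n
    have h3 : P j ≤ j x - dualPenalty s P x :=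
      (summable_sqDist ha' has hz hjs).tsum_le_of_sum_range_le fun n => by
        have := h1 n
        unfold sqDistSum at this
        linarith
    linarith
  refine ⟨j, hjs, by linarith [hP j], fun θ hθ => ?_⟩
  obtain ⟨_, ⟨k, rfl⟩, hk⟩ := Metric.mem_closure_iff.1 hjD (θ / 4) (by positivity)
  rw [dist_eq_norm] at hk
  have hak := ha k
  refine ⟨a k * θ ^ 2 / (16 * s), by positivity, fun h hh => dualPenalty_le hs.le fun w hw => ?_⟩
  have hjh := (neg_le_abs _).trans (j.le_of_opNorm_le hjs h)
  have hwh := (le_abs_self _).trans (w.le_of_opNorm_le hw h)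
  have hwx := le_dualPenalty hP hw x
  rw [map_add]
  have hθh : 0 ≤ θ * ‖h‖ := by positivity
  rcases le_or_gt ‖w - j‖ θ with hc | hc
  · have h1 := (le_abs_self _).trans ((w - j).le_of_opNorm_le hc h)
    rw [sub_apply] at h1
    linarith
  · have h1 := sqDistTsum_midpoint_add_le ha' has hz hw hjs k
    have hm : ‖midpoint ℝ w j‖ ≤ s := by
      have := (convex_closedBall (0 : X →L[ℝ] ℝ) s).midpoint_mem
        (mem_closedBall_zero_iff.2 hw) (mem_closedBall_zero_iff.2 hjs)
      exact mem_closedBall_zero_iff.1 this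
    have h2 := le_dualPenalty hP hm x
    have h3 : (midpoint ℝ w j) x = (w x + j x) / 2 := by
      rw [midpoint_eq_smul_add, invOf_eq_inv]
      simp only [smul_apply, add_apply, smul_eq_mul]
      ring
    rw [h3] at h2
    have h4 : θ / 2 ≤ ‖w - z k‖ - ‖j - z k‖ := by
      have := norm_sub_le_norm_sub_add_norm_sub w (z k) j
      rw [norm_sub_rev (z k) j] at this
      linarith
    have h5 : a k * (θ / 2) ^ 2 ≤ a k * (‖w - z k‖ - ‖j - z k‖) ^ 2 := by
      gcongr
    have h6 : 2 * (s * ‖h‖) ≤ a k * θ ^ 2 / 8 := by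
      rw [lt_div_iff₀ (by positivity)] at hh
      linarith
    rw [← hPdef] at h1
    linarith

/-- A smooth variational principle in reflexive spaces: a nonnegative function `f` which is weakly
sequentially lower semicontinuous on a bounded set `A` has, at an almost minimizer `x` of
`f + s * ‖·‖` on `A`, a Fréchet subgradient `-j` of norm at most `s`, and `j x` is almost
`s * ‖x‖`. -/
lemma exists_frechet_subgradient_of_weakly_lsc
    (hrefl : Function.Surjective (NormedSpace.inclusionInDoubleDual ℝ X))
    {A : Set X} {f : X → ℝ} {R s η : ℝ} (hs : 0 < s) (hη : 0 < η) (hA : A.Nonempty)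
    (hAR : ∀ x ∈ A, ‖x‖ ≤ R) (hf : ∀ x ∈ A, 0 ≤ f x)
    (hlsc : ∀ (x : ℕ → X) (v : X) (c : ℝ), (∀ k, x k ∈ A) →
      (∀ g : X →L[ℝ] ℝ, Tendsto (fun k => g (x k)) atTop (𝓝 (g v))) →
      Tendsto (fun k => f (x k)) atTop (𝓝 c) → v ∈ A ∧ f v ≤ c) :
    ∃ x ∈ A, ∃ j : X →L[ℝ] ℝ, ‖j‖ ≤ s ∧ (∀ y ∈ A, f x + s * ‖x‖ ≤ f y + s * ‖y‖ + η) ∧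
      s * ‖x‖ - η ≤ j x ∧
      ∀ θ > 0, ∃ δ > 0, ∀ y ∈ A, ‖y - x‖ < δ → f x - j (y - x) - θ * ‖y - x‖ ≤ f y := by
  let a : ℕ → ℝ := fun k => η / (4 * s ^ 2) / 2 / 2 ^ k
  have ha : ∀ k, 0 < a k := fun k => by positivity
  have ha' : ∀ k, 0 ≤ a k := fun k => (ha k).le
  have has : Summable a := summable_geometric_two' _
  let τ : ℕ → ℝ := fun n => (∑' k, a (k + n)) * (4 * s ^ 2)
  have hτ : ∀ n, 0 < τ n := fun n =>
    mul_pos (((summable_nat_add_iff n).2 has).tsum_pos (fun k => ha' _) 0 (ha _)) (by positivity)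
  have hτ0 : Tendsto τ atTop (𝓝 0) := by
    simpa using (tendsto_sum_nat_add a).mul_const (4 * s ^ 2)
  have hτη : (∑' k, a (k + 0)) * (4 * s ^ 2) = η := by
    simp only [add_zero, a]
    rw [tsum_geometric_two']
    field_simp
  obtain ⟨y, z, hz, hy, hyz, hmid⟩ := exists_minimizing_seq hs.le ha' hτ hA hf
  set P := sqDistTsum a z
  have hP : ∀ w, 0 ≤ P w := sqDistTsum_nonneg ha'
  have hPn : ∀ n w, 0 ≤ sqDistSum a z n w := fun n => sqDistSum_nonneg ha' n
  have hPη : ∀ w, ‖w‖ ≤ s → P w ≤ η := fun w hw => by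
    have := sqDistTsum_le ha' has hz 0 hw
    rw [hτη] at this
    simpa [sqDistSum] using this
  set g := dualPenalty s P
  have hg_le : ∀ n v, g v ≤ dualPenalty s (sqDistSum a z n) v := fun n v => by
    simpa using dualPenalty_le_dualPenalty_add hs.le (hPn n) (τ := 0)
      (fun w hw => by simpa using sqDistSum_le_sqDistTsum ha' has hz n hw) v
  have hle_g : ∀ n v, dualPenalty s (sqDistSum a z n) v ≤ g v + τ n := fun n =>
    dualPenalty_le_dualPenalty_add hs.le hP fun w hw => sqDistTsum_le ha' has hz n hw
  have hmin : ∀ m, ∀ v ∈ A, f (y (2 * m)) + g (y (2 * m)) ≤ f v + g v + 2 * τ (2 * m) := by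
    intro m v hv
    have := (hy m).2 v hv
    have := hg_le (2 * m) (y (2 * m))
    have := hle_g (2 * m) v
    linarith
  have hg_lower : ∀ v, s * ‖v‖ - η ≤ g v := mul_norm_sub_le_dualPenalty hs.le hP hPη
  have hg_upper : ∀ v, g v ≤ s * ‖v‖ := dualPenalty_le_mul_norm hs.le hP
  obtain ⟨x, σ, hσ, hσx⟩ := exists_weakly_convergent_subseq hrefl
    (x := fun m => y (2 * m)) (fun m => hAR _ (hy m).1)
  obtain ⟨T, hT⟩ := hτ0.bddAbove_range
  obtain ⟨v₀, hv₀⟩ := hA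
  obtain ⟨c, -, ρ, hρ, hc⟩ := (isCompact_Icc (a := 0) (b := f v₀ + g v₀ + 2 * T + η)).tendsto_subseq
    (x := fun m => f (y (2 * σ m))) (fun m => ⟨hf _ (hy _).1, by
      have h1 := hmin (σ m) v₀ hv₀
      have h2 := hg_lower (y (2 * σ m))
      have h3 := hT ⟨2 * σ m, rfl⟩
      have : 0 ≤ s * ‖y (2 * σ m)‖ := by positivity
      linarith⟩)
  have hweak : ∀ w : X →L[ℝ] ℝ, Tendsto (fun k => w (y (2 * σ (ρ k)))) atTop (𝓝 (w x)) :=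
    fun w => (hσx w).comp hρ.tendsto_atTop
  obtain ⟨hxA, hxc⟩ := hlsc (fun k => y (2 * σ (ρ k))) x c (fun k => (hy _).1) hweak hc
  have hτ' : Tendsto (fun k => τ (2 * σ (ρ k))) atTop (𝓝 0) :=
    hτ0.comp ((tendsto_id.const_mul_atTop' two_pos).comp
      (hσ.tendsto_atTop.comp hρ.tendsto_atTop))
  have hxmin : ∀ v ∈ A, f x + g x ≤ f v + g v := by
    intro v hv
    have : g x ≤ f v + g v - c := dualPenalty_le hs.le fun w hw => by
      have h1 := ((hweak w).sub_const (P w)).add hc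
      have h2 := (tendsto_const_nhds (x := f v + g v)).add (hτ'.const_mul 2)
      have h3 := le_of_tendsto_of_tendsto' h1 h2 fun k => by
        have h4 := hmin (σ (ρ k)) v hv
        have h5 := le_dualPenalty hP hw (y (2 * σ (ρ k)))
        simp only [Function.comp_apply]
        linarith
      linarith
    linarith
  have hxy : x ∈ closure (Set.range y) := by
    refine Convex.mem_of_tendsto_weak ?_ isClosed_closure
      (Eventually.of_forall fun k => subset_closure ⟨_, rfl⟩) hweak
    refine isClosed_closure.convex_of_midpoint_mem fun u hu v hv => ?_
    refine map_mem_closure₂ (f := fun u v => midpoint ℝ u v) (by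
      simp only [midpoint_eq_smul_add]; fun_prop) hu hv ?_
    rintro _ ⟨i, rfl⟩ _ ⟨k, rfl⟩
    obtain ⟨n, hn, -⟩ := hmid i k
    exact ⟨n, hn⟩
  obtain ⟨j, hjs, hjx, hj⟩ := exists_supergradient_dualPenalty hrefl hs ha has hz
    (fun i k => (hmid i k).imp fun n hn => hn.2) (x := x) (by
      intro θ hθ
      obtain ⟨_, ⟨i, rfl⟩, hi⟩ := Metric.mem_closure_iff.1 hxy (θ / (4 * s)) (by positivity)
      rw [dist_eq_norm, lt_div_iff₀ (by positivity)] at hi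
      obtain ⟨N, hN⟩ := eventually_atTop.1 (hτ0.eventually_lt_const (show 0 < θ / 4 by positivity))
      have hm : N + 1 ≤ Nat.pair i (N + 1) := Nat.right_le_pair _ _
      have h1 := hyz (Nat.pair i (N + 1)) (by omega)
      rw [Nat.unpair_pair] at h1
      set n := 2 * Nat.pair i (N + 1)
      have h2 := hN n (by omega)
      have h3 := sqDistTsum_le ha' has hz n (hz n)
      have h4 := dualPenalty_le_add_mul_norm_sub hs.le hP x (y i)
      have h5 := hg_le n (y i)
      have h6 := (neg_le_abs _).trans ((z n).le_of_opNorm_le (hz n) (x - y i))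
      rw [map_sub] at h6
      refine ⟨n, ?_⟩
      linarith)
  refine ⟨x, hxA, j, hjs, fun v hv => ?_, (hg_lower x).trans hjx, fun θ hθ => ?_⟩
  · have := hxmin v hv
    have := hg_lower x
    have := hg_upper v
    linarith
  · obtain ⟨δ, hδ, h⟩ := hj θ hθ
    refine ⟨δ, hδ, fun v hv hvx => ?_⟩
    have h1 := h (v - x) hvx
    rw [add_sub_cancel] at h1
    have := hxmin v hv
    linarith

/-- The upper envelope of the affine functions `φ u + ⟨v, · - u⟩` over the pairs `(u, v) ∈ G`. -/
noncomputable def affineEnvelope (φ : X → EReal) (G : Set (X × (X →L[ℝ] ℝ))) (x : X) : EReal :=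
  ⨆ p : G, φ p.1.1 + ((p.1.2 (x - p.1.1) : ℝ) : EReal)

section AffineEnvelope

variable {φ : X → EReal} {G : Set (X × (X →L[ℝ] ℝ))}

lemma le_affineEnvelope {u : X} {v : X →L[ℝ] ℝ} (h : (u, v) ∈ G) (x : X) :
    φ u + ((v (x - u) : ℝ) : EReal) ≤ affineEnvelope φ G x :=
  le_iSup (fun p : G => φ p.1.1 + ((p.1.2 (x - p.1.1) : ℝ) : EReal)) ⟨(u, v), h⟩

lemma lowerSemicontinuous_affineEnvelope (hG : ∀ p ∈ G, ∃ r : ℝ, φ p.1 = r) :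
    LowerSemicontinuous (affineEnvelope φ G) := by
  refine lowerSemicontinuous_iSup fun p => Continuous.lowerSemicontinuous ?_
  obtain ⟨r, hr⟩ := hG p.1 p.2
  simp only [hr, ← EReal.coe_add]
  exact continuous_coe_real_ereal.comp (by fun_prop)

lemma erealConvexOn_affineEnvelope (hG : ∀ p ∈ G, ∃ r : ℝ, φ p.1 = r) :
    ERealConvexOn Set.univ (affineEnvelope φ G) := by
  intro x _ y _ t ht ht'
  refine iSup_le fun p => ?_
  obtain ⟨r, hr⟩ := hG p.1 p.2
  have h : φ p.1.1 + ((p.1.2 (t • x + (1 - t) • y - p.1.1) : ℝ) : EReal) =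
      (t : EReal) * (φ p.1.1 + ((p.1.2 (x - p.1.1) : ℝ) : EReal)) +
      ((1 - t : ℝ) : EReal) * (φ p.1.1 + ((p.1.2 (y - p.1.1) : ℝ) : EReal)) := by
    rw [hr]
    norm_cast
    simp only [map_sub, map_add, map_smul, smul_eq_mul]
    ring
  rw [h]
  exact add_le_add
    (mul_le_mul_of_nonneg_left (le_affineEnvelope p.2 x) (by exact_mod_cast ht))
    (mul_le_mul_of_nonneg_left (le_affineEnvelope p.2 y) (by exact_mod_cast sub_nonneg.2 ht'))

end AffineEnvelope

lemma EReal.exists_eq_coe {a : EReal} (h : a ≠ ⊥) (h' : a ≠ ⊤) : ∃ r : ℝ, a = r :=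
  ⟨a.toReal, (EReal.coe_toReal h' h).symm⟩

lemma mem_limitingSubdiff_of_epsSubdiff_zero {φ : X → EReal} {x : X} {v : X →L[ℝ] ℝ}
    (h : v ∈ EpsSubdiff φ 0 x) : v ∈ LimitingSubdiff φ x :=
  ⟨fun _ => x, fun _ => v, fun _ => 0, fun _ => le_rfl, tendsto_const_nhds, tendsto_const_nhds,
    tendsto_const_nhds, fun _ => h, fun _ => tendsto_const_nhds⟩

/-- If `φ` majorizes an affine function near `u`, nearly touches it at a nearby point, and all
affine functions supporting `φ` through nearby Fréchet subgradients stay below `α` at `u`,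
then `φ u ≤ α`. -/
lemma le_of_forall_frechet_subgradient_le
    (hrefl : Function.Surjective (NormedSpace.inclusionInDoubleDual ℝ X))
    {φ : X → EReal} (hlsc : LowerSemicontinuous φ) {u xbar : X} {us : X →L[ℝ] ℝ} {α R r s : ℝ}
    (hs : 0 < s) (hr : 0 < r) (hrR : 3 * r < R)
    (hmaj : ∀ x, ‖x - u‖ ≤ R → ((α + us (x - u) : ℝ) : EReal) ≤ φ x)
    (hwlsc : ∀ x, ‖x - u‖ ≤ R → ∀ xk : ℕ → X,
      (∀ f : X →L[ℝ] ℝ, Tendsto (fun k => f (xk k)) atTop (𝓝 (f x))) →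
      φ x ≤ Filter.liminf (fun k => φ (xk k)) atTop)
    (hxbar : ‖xbar - u‖ ≤ r)
    (htouch : φ xbar ≤ ((α + us (xbar - u) + s * r : ℝ) : EReal))
    (hsupp : ∀ (x : X) (v : X →L[ℝ] ℝ), ‖x - u‖ ≤ 3 * r → ‖v - us‖ ≤ s →
      φ x ≤ ((α + us (x - u) + 3 * (s * r) : ℝ) : EReal) → v ∈ EpsSubdiff φ 0 x →
      φ x + ((v (u - x) : ℝ) : EReal) ≤ α) :
    φ u ≤ α := by
  by_contra! hlt
  have hsr := mul_pos hs hr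
  have hbot : ∀ h : X, ‖h‖ ≤ R → φ (u + h) ≠ ⊥ := fun h hh =>
    ne_bot_of_le_ne_bot (EReal.coe_ne_bot _) (hmaj (u + h) (by simpa using hh))
  set A : Set X := {h | ‖h‖ ≤ R ∧ φ (u + h) ≠ ⊤} with hAdef
  set f : X → ℝ := fun h => (φ (u + h)).toReal - α - us h with hf
  have hφf : ∀ h ∈ A, φ (u + h) = ((f h + α + us h : ℝ) : EReal) := fun h hh => by
    rw [← EReal.coe_toReal hh.2 (hbot h hh.1)]
    simp only [hf]
    congr 1
    ring
  have hf0 : ∀ h ∈ A, 0 ≤ f h := fun h hh => by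
    have := hmaj (u + h) (by simpa using hh.1)
    rw [hφf h hh, EReal.coe_le_coe_iff, add_sub_cancel_left] at this
    linarith
  have hmem : xbar - u ∈ A :=
    ⟨by linarith, by
      rw [add_sub_cancel]; exact ne_top_of_le_ne_top (EReal.coe_ne_top _) htouch⟩
  have hfx : f (xbar - u) ≤ s * r := by
    have := hφf _ hmem
    rw [add_sub_cancel] at this
    rw [this, EReal.coe_le_coe_iff] at htouch
    linarith
  obtain ⟨c, hαc, hcu⟩ := EReal.lt_iff_exists_real_btwn.1 hlt
  rw [EReal.coe_lt_coe_iff] at hαc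
  obtain ⟨ρ, hρ, hρc⟩ : ∃ ρ > 0, ∀ h ∈ A, ‖h‖ < ρ → (c - α) / 2 ≤ f h := by
    obtain ⟨ρ₁, hρ₁, h₁⟩ := Metric.eventually_nhds_iff.1 (hlsc u c hcu)
    have hcont : ContinuousAt us 0 := us.continuous.continuousAt
    obtain ⟨ρ₂, hρ₂, h₂⟩ := Metric.continuousAt_iff.1 hcont ((c - α) / 2) (by linarith)
    refine ⟨min ρ₁ ρ₂, lt_min hρ₁ hρ₂, fun h hh hn => ?_⟩
    have h1 : (c : EReal) < φ (u + h) := h₁ (by simpa using hn.trans_le (min_le_left _ _))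
    have h2 := h₂ (x := h) (by simpa using hn.trans_le (min_le_right _ _))
    rw [hφf h hh, EReal.coe_lt_coe_iff] at h1
    rw [map_zero, Real.dist_eq, sub_zero] at h2
    linarith [le_abs_self (us h)]
  set m := min ((c - α) / 2) (s * ρ) with hm
  have hm0 : 0 < m := lt_min (by linarith) (mul_pos hs hρ)
  have hmf : ∀ h ∈ A, m ≤ f h + s * ‖h‖ := fun h hh => by
    rcases lt_or_ge ‖h‖ ρ with hlt | hge
    · have := hρc h hh hlt
      have := min_le_left ((c - α) / 2) (s * ρ)
      nlinarith [norm_nonneg h]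
    · have := hf0 h hh
      have := min_le_right ((c - α) / 2) (s * ρ)
      nlinarith
  obtain ⟨h, hhA, j, hj, hmin, hjh, hfre⟩ :=
    exists_frechet_subgradient_of_weakly_lsc hrefl (A := A) (f := f) (R := R) (s := s)
      (η := min (m / 2) (s * r)) hs (lt_min (by linarith) hsr) ⟨_, hmem⟩ (fun x hx => hx.1) hf0 (by
        intro x v c hx hxv hxc
        have hv : ‖v‖ ≤ R := by
          simpa using (convex_closedBall (0 : X) R).mem_of_tendsto_weak Metric.isClosed_closedBall
            (l := atTop) (x := x) (a := v) (.of_forall fun k => by simpa using (hx k).1) hxv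
        have hle := hwlsc (u + v) (by simpa using hv) (fun k => u + x k) fun g => by
          simpa using (hxv g).const_add (g u)
        have hlim : Tendsto (fun k => φ (u + x k)) atTop (𝓝 ((c + α + us v : ℝ) : EReal)) := by
          simp only [fun k => hφf (x k) (hx k)]
          exact (continuous_coe_real_ereal.tendsto _).comp ((hxc.add_const α).add (hxv us))
        rw [hlim.liminf_eq] at hle
        have hvA : v ∈ A := ⟨hv, ne_top_of_le_ne_top (EReal.coe_ne_top _) hle⟩
        rw [hφf v hvA, EReal.coe_le_coe_iff] at hle
        exact ⟨hvA, by linarith⟩)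
  have hη₁ := min_le_left (m / 2) (s * r)
  have hη₂ := min_le_right (m / 2) (s * r)
  have hloc := hmin _ hmem
  have hsx : s * ‖xbar - u‖ ≤ s * r := by gcongr
  have hfh := hf0 h hhA
  have hsh : 0 ≤ s * ‖h‖ := by positivity
  have hh3 : ‖h‖ ≤ 3 * r := by
    by_contra! hcon
    nlinarith
  have hv : us - j ∈ EpsSubdiff φ 0 (u + h) := by
    intro θ hθ
    obtain ⟨δ, hδ, hδy⟩ := hfre θ hθ
    refine ⟨min δ (R - 3 * r), lt_min hδ (by linarith), fun y hy => ?_⟩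
    by_cases hyt : φ y = ⊤
    · rw [hyt]; exact le_top
    have hsub : y - u - h = y - (u + h) := by abel
    have hyA : y - u ∈ A := by
      refine ⟨?_, by rwa [add_sub_cancel]⟩
      have h1 : ‖y - (u + h)‖ < R - 3 * r := hy.trans_le (min_le_right _ _)
      have h2 := norm_add_le (y - (u + h)) h
      rw [show y - (u + h) + h = y - u by abel] at h2
      linarith
    have hfy := hδy (y - u) hyA (by rw [hsub]; exact hy.trans_le (min_le_left _ _))
    have hφy := hφf _ hyA
    rw [add_sub_cancel] at hφy
    rw [hφy, hφf h hhA, ← EReal.coe_add, EReal.coe_le_coe_iff, sub_apply]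
    rw [hsub] at hfy
    have : us (y - (u + h)) = us (y - u) - us h := by rw [← hsub, map_sub]
    linarith
  have hfin := hsupp (u + h) (us - j) (by simpa using hh3) (by simpa using hj)
    (by rw [hφf h hhA, EReal.coe_le_coe_iff, add_sub_cancel_left]; linarith) hv
  rw [hφf h hhA, ← EReal.coe_add, EReal.coe_le_coe_iff, show u - (u + h) = -h by abel,
    map_neg, sub_apply] at hfin
  linarith [hmf h hhA]

/-- in a reflexive Banach space, the localized subgradient
inequality implies variational convexity for weakly sequentially l.s.c.
functions. -/
theorem subgradient_inequality_implies_variationallyConvex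
    [CompleteSpace X]
    (hrefl : Function.Surjective (NormedSpace.inclusionInDoubleDual ℝ X))
    (φ : X → EReal) (hlsc : LowerSemicontinuous φ) (hnb : ∀ x, φ x ≠ ⊥)
    (xbar : X) (hdom : φ xbar ≠ ⊤) (xsbar : X →L[ℝ] ℝ)
    (hsub : xsbar ∈ LimitingSubdiff φ xbar)
    (hwlsc : WeaklySeqLscAround φ xbar)
    (U : Set X) (V : Set (X →L[ℝ] ℝ)) (ε : ℝ)
    (hU : IsOpen U) (hUc : Convex ℝ U) (hxU : xbar ∈ U)
    (hV : IsOpen V) (hVc : Convex ℝ V) (hxV : xsbar ∈ V) (hε : 0 < ε)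
    (hineq : ∀ (u : X) (us : X →L[ℝ] ℝ),
      u ∈ U → φ u < φ xbar + (ε : EReal) → us ∈ V →
      us ∈ LimitingSubdiff φ u →
      ∀ x ∈ U, φ u + ((us (x - u) : ℝ) : EReal) ≤ φ x) :
    VariationallyConvexAt φ xbar xsbar := by
  obtain ⟨δ, hδ, hw⟩ := hwlsc
  obtain ⟨d, hd, hdU⟩ := Metric.isOpen_iff.1 hU xbar hxU
  obtain ⟨e, he, heV⟩ := Metric.isOpen_iff.1 hV xsbar hxV
  obtain ⟨b, hb⟩ := EReal.exists_eq_coe (hnb xbar) hdom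
  obtain ⟨s, hs, hse⟩ : ∃ s > 0, 2 * s < e := ⟨e / 3, by linarith, by linarith⟩
  obtain ⟨R, hR, hRδ, hRd⟩ : ∃ R > 0, 2 * R < δ ∧ 2 * R < d :=
    ⟨min δ d / 3, by positivity, by linarith [min_le_left δ d, lt_min hδ hd],
      by linarith [min_le_right δ d, lt_min hδ hd]⟩
  set K := ‖xsbar‖ + s with hK
  have hK0 : 0 < K := by positivity
  obtain ⟨r, hr, hrR, hrε⟩ : ∃ r > 0, 4 * r < R ∧ (4 * K + 3 * s) * r < ε := by
    have hC : 0 < 4 * K + 3 * s := by positivity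
    refine ⟨min (R / 5) (ε / (2 * (4 * K + 3 * s))), by positivity, ?_, ?_⟩
    · linarith [min_le_left (R / 5) (ε / (2 * (4 * K + 3 * s)))]
    · calc (4 * K + 3 * s) * min (R / 5) (ε / (2 * (4 * K + 3 * s)))
          ≤ (4 * K + 3 * s) * (ε / (2 * (4 * K + 3 * s))) := by gcongr; exact min_le_right _ _
        _ = ε / 2 := by field_simp
        _ < ε := by linarith
  set G : Set (X × (X →L[ℝ] ℝ)) :=
    {p | p.1 ∈ U ∧ φ p.1 < φ xbar + (ε : EReal) ∧ p.2 ∈ V ∧ p.2 ∈ LimitingSubdiff φ p.1} with hG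
  have hGreal : ∀ p ∈ G, ∃ a : ℝ, φ p.1 = a := fun p hp =>
    EReal.exists_eq_coe (hnb _) (ne_top_of_lt hp.2.1)
  have hψφ : ∀ x ∈ U, affineEnvelope φ G x ≤ φ x := fun x hx =>
    iSup_le fun p => hineq _ _ p.2.1 p.2.2.1 p.2.2.2.1 p.2.2.2.2 x hx
  have hψG : ∀ {u v}, (u, v) ∈ G → affineEnvelope φ G u = φ u := fun {u v} h =>
    le_antisymm (hψφ u h.1) (by simpa using le_affineEnvelope h u)
  have hxG : (xbar, xsbar) ∈ G := by
    refine ⟨hxU, ?_, hxV, hsub⟩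
    rw [hb, ← EReal.coe_add, EReal.coe_lt_coe_iff]
    linarith
  have hball : ∀ x u : X, ‖x - u‖ ≤ R → ‖u - xbar‖ < r → ‖x - xbar‖ < 2 * R :=
    fun x u hx hu => by
      have := norm_add_le (x - u) (u - xbar)
      rw [sub_add_sub_cancel] at this
      linarith
  have hrU : Metric.ball xbar r ⊆ U := (Metric.ball_subset_ball (by linarith)).trans hdU
  have hsV : Metric.ball xsbar s ⊆ V := (Metric.ball_subset_ball (by linarith)).trans heV
  have hreal : ∀ u ∈ Metric.ball xbar r, ∀ us ∈ Metric.ball xsbar s,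
      us ∈ ConvexSubdiff (affineEnvelope φ G) u →
      φ u = affineEnvelope φ G u ∧ φ u < φ xbar + (ε : EReal) := by
    intro u hu us hus hsubu
    have huU := hrU hu
    rw [mem_ball_iff_norm] at hu hus
    have hlow := le_affineEnvelope (φ := φ) hxG u
    have hup := (hsubu xbar).trans (hψφ xbar hxU)
    obtain ⟨α, hα⟩ : ∃ α : ℝ, affineEnvelope φ G u = α := by
      refine EReal.exists_eq_coe ?_ ?_
      · rw [hb, ← EReal.coe_add] at hlow
        exact ne_bot_of_le_ne_bot (EReal.coe_ne_bot _) hlow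
      · intro htop
        rw [htop, EReal.top_add_coe, top_le_iff] at hup
        exact hdom hup
    rw [hα, hb, ← EReal.coe_add, EReal.coe_le_coe_iff] at hlow hup
    have husK : ‖us‖ ≤ K := by
      have := norm_add_le (us - xsbar) xsbar
      rw [sub_add_cancel] at this
      linarith
    have hbd : ∀ y : X, ∀ t : ℝ, ‖y‖ ≤ t → |us y| ≤ K * t := fun y t ht =>
      (us.le_opNorm y).trans (by gcongr)
    have hxu : ‖xbar - u‖ ≤ r := by rw [norm_sub_rev]; exact hu.le
    have hαb : α ≤ b + K * r := by linarith [neg_abs_le (us (xbar - u)), hbd _ _ hxu]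
    have hsr : 0 < s * r := mul_pos hs hr
    have hle : φ u ≤ α := by
      refine le_of_forall_frechet_subgradient_le hrefl hlsc (xbar := xbar) (us := us) hs hr
        (by linarith : 3 * r < R) (fun x hx => ?_)
        (fun x hx => hw x ((hball x u hx hu).trans hRδ)) hxu ?_ fun x v hx hv hφx hvx => ?_
      · have hxU' : x ∈ U := hdU (mem_ball_iff_norm.2 ((hball x u hx hu).trans hRd))
        have := (hsubu x).trans (hψφ x hxU')
        rwa [hα, ← EReal.coe_add] at this
      · rw [hb, EReal.coe_le_coe_iff]
        have h1 : (xsbar - us) (xbar - u) ≤ s * r := by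
          refine (le_abs_self _).trans (((xsbar - us).le_opNorm _).trans ?_)
          rw [norm_sub_rev xsbar us]
          gcongr
        rw [sub_apply] at h1
        have h2 : xsbar (u - xbar) = -xsbar (xbar - u) := by rw [← map_neg, neg_sub]
        linarith
      · rw [← hα]
        refine le_affineEnvelope (φ := φ) (G := G)
          ⟨?_, ?_, ?_, mem_limitingSubdiff_of_epsSubdiff_zero hvx⟩ u
        · exact hdU (mem_ball_iff_norm.2 ((hball x u (by linarith) hu).trans hRd))
        · refine hφx.trans_lt ?_
          rw [hb, ← EReal.coe_add, EReal.coe_lt_coe_iff]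
          linarith [le_abs_self (us (x - u)), hbd _ _ hx]
        · refine heV (mem_ball_iff_norm.2 ?_)
          have := norm_add_le (v - us) (us - xsbar)
          rw [sub_add_sub_cancel] at this
          linarith
    refine ⟨le_antisymm (hle.trans_eq hα.symm) (hψφ u huU), hle.trans_lt ?_⟩
    rw [hb, ← EReal.coe_add, EReal.coe_lt_coe_iff]
    linarith [mul_pos hK0 hr]
  refine ⟨Metric.ball xbar r, Metric.ball xsbar s, Metric.isOpen_ball, convex_ball _ _,
    Metric.mem_ball_self hr, Metric.isOpen_ball, convex_ball _ _, Metric.mem_ball_self hs,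
    affineEnvelope φ G, ε, hε, erealConvexOn_affineEnvelope hGreal,
    lowerSemicontinuous_affineEnvelope hGreal, fun x hx => hψφ x (hrU hx), fun u us => ⟨?_, ?_⟩,
    fun u us h => (hreal u h.1 us h.2.1 h.2.2).1⟩
  · rintro ⟨hu, hφu, hus, hsubu⟩
    have hmem : (u, us) ∈ G := ⟨hrU hu, hφu, hsV hus, hsubu⟩
    exact ⟨hu, hus, fun y => by rw [hψG hmem]; exact le_affineEnvelope hmem y⟩
  · rintro ⟨hu, hus, hsubu⟩
    obtain ⟨heq, hlt⟩ := hreal u hu us hus hsubu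
    refine ⟨hu, hlt, hus, mem_limitingSubdiff_of_epsSubdiff_zero fun θ hθ => ?_⟩
    obtain ⟨ρ, hρ, hρU⟩ := Metric.isOpen_iff.1 hU u (hrU hu)
    refine ⟨ρ, hρ, fun y hy => ?_⟩
    rw [heq]
    refine (add_le_add le_rfl (EReal.coe_le_coe_iff.2 ?_)).trans
      ((hsubu y).trans (hψφ y (hρU (mem_ball_iff_norm.2 hy))))
    linarith [mul_nonneg (by linarith : 0 ≤ 0 + θ) (norm_nonneg (y - u))]
end
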